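/- arXiv:2201.09533 — 7 statements merged into one kernel-verified Lean document; each statement's English description precedes it below -/
import Mathlib

section
/- Let N be a natural number, F : ℝ → ℂ → Matrix (Fin N) (Fin N) ℂ, β : ℝ → ℂ, B : ℝ → (Fin N → ℂ), and x̃ : Fin N → ℂ. Assume: (i) β and B are differentiable at 0, and write β₀ = β 0, B₀ = B 0; (ii) there exist matrices Fε and Fβ such that F(ε, z) = F(0, β₀) + ε·Fε + (z − β₀)·Fβ + o(|ε| + |z − β₀|) as (ε, z) → (0, β₀); (iii) for all ε in some neighborhood of 0 in ℝ, (F ε (β ε)).mulVec (B ε) = 0; (iv) the left null-vector condition Matrix.vecMul (star x̃) (F 0 β₀) = 0 holds; (v) the scalar c := star x̃ ⬝ᵥ (Fβ.mulVec B₀) is nonzero. Then deriv β 0 = −(star x̃ ⬝ᵥ (Fε.mulVec B₀)) / c. -/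
open Matrix Filter Asymptotics

attribute [local instance] Matrix.normedAddCommGroup Matrix.normedSpace

/-- First-order perturbation formula for a nonlinear matrix eigenvalue problem
`F (ε, β) ⬝ B = 0`. -/
theorem deriv_eigenvalue_perturbation
    (N : ℕ) (F : ℝ → ℂ → Matrix (Fin N) (Fin N) ℂ)
    (β : ℝ → ℂ) (B : ℝ → (Fin N → ℂ)) (xt : Fin N → ℂ)
    (Fε Fβ : Matrix (Fin N) (Fin N) ℂ)
    (hβ : DifferentiableAt ℝ β 0) (hB : DifferentiableAt ℝ B 0)
    (hF : (fun p : ℝ × ℂ =>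
        F p.1 p.2 - F 0 (β 0) - (p.1 : ℂ) • Fε - (p.2 - β 0) • Fβ)
        =o[nhds ((0 : ℝ), β 0)] (fun p : ℝ × ℂ => |p.1| + ‖p.2 - β 0‖))
    (hnull : ∀ᶠ ε in nhds (0 : ℝ), (F ε (β ε)).mulVec (B ε) = 0)
    (hleft : Matrix.vecMul (star xt) (F 0 (β 0)) = 0)
    (hc : star xt ⬝ᵥ (Fβ.mulVec (B 0)) ≠ 0) :
    deriv β 0 =
      -(star xt ⬝ᵥ (Fε.mulVec (B 0))) / (star xt ⬝ᵥ (Fβ.mulVec (B 0))) := by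
  have hb := hβ.hasDerivAt
  have hb' := hasDerivAt_iff_isLittleO.1 hb
  have hO : (fun ε : ℝ => |ε| + ‖β ε - β 0‖) =O[nhds 0] (fun ε : ℝ => ε) := by
    have h1 : (fun ε : ℝ => |ε|) =O[nhds 0] (fun ε : ℝ => ε) :=
      (isBigO_refl (fun ε : ℝ => ε) _).norm_left
    have h2 : (fun ε : ℝ => ‖β ε - β 0‖) =O[nhds 0] (fun ε : ℝ => ε) := by
      have := hb.isBigO_sub
      simpa using this.norm_left
    exact h1.add h2
  have ht : Tendsto (fun ε : ℝ => (ε, β ε)) (nhds 0) (nhds ((0 : ℝ), β 0)) :=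
    (continuousAt_id.prodMk hβ.continuousAt)
  have hr := (hF.comp_tendsto ht).trans_isBigO hO
  have hG : ∀ i j, HasDerivAt (fun ε => F ε (β ε) i j)
      (Fε i j + deriv β 0 * Fβ i j) 0 := by
    intro i j
    rw [hasDerivAt_iff_isLittleO]
    have h1 : (fun ε : ℝ => (F ε (β ε) - F 0 (β 0) - (ε : ℂ) • Fε - (β ε - β 0) • Fβ) i j)
        =o[nhds 0] (fun ε : ℝ => ε) := by
      refine IsBigO.trans_isLittleO ?_ hr
      exact IsBigO.of_bound 1 (Eventually.of_forall fun ε => by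
        rw [one_mul]; exact Matrix.norm_entry_le_entrywise_sup_norm _)
    have h2 : (fun ε : ℝ => Fβ i j * (β ε - β 0 - (ε - 0) • deriv β 0))
        =o[nhds 0] (fun ε : ℝ => ε) := by
      have := hb'.const_mul_left (Fβ i j)
      simpa using this
    have h3 := h1.add h2
    simp only [sub_zero]
    refine h3.congr_left fun ε => ?_
    simp only [Matrix.sub_apply, Matrix.smul_apply, smul_eq_mul, Complex.real_smul, sub_zero]
    ring
  have hBj : ∀ j, HasDerivAt (fun ε => B ε j) (deriv B 0 j) 0 :=
    hasDerivAt_pi.1 hB.hasDerivAt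
  have hS : HasDerivAt (fun ε => ∑ i, star xt i * ∑ j, F ε (β ε) i j * B ε j)
      (∑ i, star xt i * ∑ j, ((Fε i j + deriv β 0 * Fβ i j) * B 0 j
        + F 0 (β 0) i j * deriv B 0 j)) 0 :=
    HasDerivAt.fun_sum fun i _ => HasDerivAt.const_mul _
      (HasDerivAt.fun_sum fun j _ => (hG i j).mul (hBj j))
  have hZ : (fun ε => ∑ i, star xt i * ∑ j, F ε (β ε) i j * B ε j) =ᶠ[nhds 0]
      fun _ => (0 : ℂ) := by
    filter_upwards [hnull] with ε hε
    refine Finset.sum_eq_zero fun i _ => ?_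
    have : ∑ j, F ε (β ε) i j * B ε j = 0 := congrFun hε i
    rw [this, mul_zero]
  have h0 := hS.unique ((hasDerivAt_const (0 : ℝ) (0 : ℂ)).congr_of_eventuallyEq hZ)
  have hE : star xt ⬝ᵥ (Fε.mulVec (B 0)) + deriv β 0 * (star xt ⬝ᵥ (Fβ.mulVec (B 0)))
      + star xt ⬝ᵥ ((F 0 (β 0)).mulVec (deriv B 0)) = 0 := by
    rw [← h0]
    simp only [dotProduct, Matrix.mulVec, Finset.mul_sum, ← Finset.sum_add_distrib]
    refine Finset.sum_congr rfl fun i _ => Finset.sum_congr rfl fun j _ => ?_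
    ring
  rw [Matrix.dotProduct_mulVec _ (F 0 (β 0)), hleft, zero_dotProduct, add_zero] at hE
  rw [eq_div_iff hc]
  linear_combination hE
end

section
/- Let N be a natural number, S : ℝ → Matrix (Fin N) (Fin N) ℂ differentiable at 0, T : ℂ → Matrix (Fin N) (Fin N) ℂ (complex-)differentiable at β₀ := β 0, where β : ℝ → ℂ and B : ℝ → (Fin N → ℂ) are differentiable at 0 with B₀ := B 0. Let x̃ : Fin N → ℂ satisfy Matrix.vecMul (star x̃) (1 − S 0 * T β₀) = 0. Assume that for all ε in a neighborhood of 0, ((1 : Matrix (Fin N) (Fin N) ℂ) − S ε * T (β ε)).mulVec (B ε) = 0, and that the scalar c := star x̃ ⬝ᵥ ((S 0 * deriv T β₀).mulVec B₀) is nonzero. Then deriv β 0 = −(star x̃ ⬝ᵥ ((deriv S 0 * T β₀).mulVec B₀)) / c. -/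
open Matrix Filter Asymptotics

attribute [local instance] Matrix.normedAddCommGroup Matrix.normedSpace

/-- Topological-derivative formula for a resonant Floquet wavenumber `β` characterized
by singularity of `I - S(ε) * T(β)`, where `S` is the scattering matrix of the
(perturbed) unit scatterer and `T` the Schlömilch lattice-sum matrix. -/
theorem deriv_resonant_wavenumber
    (N : ℕ) (S : ℝ → Matrix (Fin N) (Fin N) ℂ)
    (T : ℂ → Matrix (Fin N) (Fin N) ℂ)
    (β : ℝ → ℂ) (B : ℝ → (Fin N → ℂ)) (xt : Fin N → ℂ)
    (hS : DifferentiableAt ℝ S 0) (hT : DifferentiableAt ℂ T (β 0))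
    (hβ : DifferentiableAt ℝ β 0) (hB : DifferentiableAt ℝ B 0)
    (hleft : Matrix.vecMul (star xt) (1 - S 0 * T (β 0)) = 0)
    (hnull : ∀ᶠ ε in nhds (0 : ℝ),
      ((1 : Matrix (Fin N) (Fin N) ℂ) - S ε * T (β ε)).mulVec (B ε) = 0)
    (hc : star xt ⬝ᵥ ((S 0 * deriv T (β 0)).mulVec (B 0)) ≠ 0) :
    deriv β 0 =
      -(star xt ⬝ᵥ ((deriv S 0 * T (β 0)).mulVec (B 0))) /
        (star xt ⬝ᵥ ((S 0 * deriv T (β 0)).mulVec (B 0))) := by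
  have hS' : ∀ i j, HasDerivAt (fun ε => S ε i j) (deriv S 0 i j) 0 :=
    fun i j => hasDerivAt_pi.1 (hasDerivAt_pi.1 hS.hasDerivAt i) j
  have hT' : ∀ i j, HasDerivAt (fun z => T z i j) (deriv T (β 0) i j) (β 0) :=
    fun i j => hasDerivAt_pi.1 (hasDerivAt_pi.1 hT.hasDerivAt i) j
  have hB' : ∀ i, HasDerivAt (fun ε => B ε i) (deriv B 0 i) 0 :=
    fun i => hasDerivAt_pi.1 hB.hasDerivAt i
  have hTβ : ∀ i j, HasDerivAt (fun ε => T (β ε) i j) (deriv T (β 0) i j * deriv β 0) 0 :=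
    fun i j => HasDerivAt.comp (0 : ℝ) (hT' i j) hβ.hasDerivAt
  have hM : ∀ i j, HasDerivAt (fun ε => (1 - S ε * T (β ε)) i j)
      ((-(deriv S 0 * T (β 0) + deriv β 0 • (S 0 * deriv T (β 0)))) i j) 0 := by
    intro i j
    have h := (HasDerivAt.fun_sum (u := Finset.univ)
      (fun k _ => (hS' i k).fun_mul (hTβ k j))).const_sub ((1 : Matrix (Fin N) (Fin N) ℂ) i j)
    refine HasDerivAt.congr_deriv h ?_
    simp only [Matrix.neg_apply, Matrix.add_apply, Matrix.smul_apply, Matrix.mul_apply,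
      Finset.sum_add_distrib, smul_eq_mul, Finset.mul_sum]
    congr 2
    exact Finset.sum_congr rfl fun k _ => by ring
  have hf : HasDerivAt (fun ε => star xt ⬝ᵥ ((1 - S ε * T (β ε)).mulVec (B ε)))
      (star xt ⬝ᵥ ((-(deriv S 0 * T (β 0) + deriv β 0 • (S 0 * deriv T (β 0)))).mulVec (B 0)
        + (1 - S 0 * T (β 0)).mulVec (deriv B 0))) 0 := by
    have h := HasDerivAt.fun_sum (u := Finset.univ) (fun i _ =>
      (HasDerivAt.fun_sum (u := Finset.univ)
        (fun j _ => (hM i j).fun_mul (hB' j))).const_mul (star xt i))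
    refine HasDerivAt.congr_deriv h ?_
    simp only [dotProduct, Matrix.mulVec, Pi.add_apply, Finset.sum_add_distrib]
  have h0 : HasDerivAt (fun ε => star xt ⬝ᵥ ((1 - S ε * T (β ε)).mulVec (B ε))) 0 0 := by
    refine (hasDerivAt_const (0 : ℝ) (0 : ℂ)).congr_of_eventuallyEq ?_
    filter_upwards [hnull] with ε hε
    rw [hε, dotProduct_zero]
  have key := hf.unique h0
  rw [dotProduct_add, Matrix.dotProduct_mulVec _ (1 - S 0 * T (β 0)), hleft, zero_dotProduct,
    add_zero, Matrix.neg_mulVec, dotProduct_neg, Matrix.add_mulVec, dotProduct_add,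
    Matrix.smul_mulVec, dotProduct_smul, smul_eq_mul] at key
  rw [eq_div_iff hc]
  linear_combination -key
end

section
/- Let (Γ₁, μ₁) and (Γ₂, μ₂) be measure spaces and ρ, ρ̂ nonzero complex constants. Let (a, a′), (b, b′), (c, c′), (d, d′), (e, e′) be pairs of measurable complex-valued functions on Γ₁ and (p, p′), (q, q′) pairs on Γ₂, such that every product appearing in the integrals below is integrable. Assume: (reciprocity identities) ∫_{Γ₁} (a·c′ − c·a′) dμ₁ + ∫_{Γ₂} (p·q′ − q·p′) dμ₂ = 0 and ∫_{Γ₁} (b·d′ − d·b′) dμ₁ = 0; (transmission conditions) c = d and (1/ρ)·c′ = (1/ρ̂)·d′ hold μ₁-almost everywhere; (adjoint boundary conditions) a = b − ρ·e and (1/ρ)·a′ = (1/ρ̂)·b′ − e′ hold μ₁-almost everywhere. Then ∫_{Γ₁} (e′·c − e·c′) dμ₁ = (1/ρ) · ∫_{Γ₂} (p′·q − p·q′) dμ₂. -/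
open MeasureTheory

/-- The adjoint identity `⟨I₋ₙ, δu⟩_{∂Ω̂} = (1/ρ)⟨ũ, δu⟩_{∂B_ε}` used in deriving the
topological derivative of the scattering matrix, stated abstractly on measure spaces.
Here `(a, a')`/`(b, b')` are the exterior/interior traces of the adjoint field on `Γ₁`,
`(c, c')`/`(d, d')` the exterior/interior traces of the field variation on `Γ₁`,
`(e, e')` the traces of the incident wave, and `(p, p')`, `(q, q')` traces on `Γ₂`. -/
theorem adjoint_pairing_identity
    {Γ₁ Γ₂ : Type*} [MeasurableSpace Γ₁] [MeasurableSpace Γ₂]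
    (μ₁ : Measure Γ₁) (μ₂ : Measure Γ₂)
    (ρ ρhat : ℂ) (hρ : ρ ≠ 0) (hρhat : ρhat ≠ 0)
    (a a' b b' c c' d d' e e' : Γ₁ → ℂ) (p p' q q' : Γ₂ → ℂ)
    (ha : Measurable a) (ha' : Measurable a') (hb : Measurable b) (hb' : Measurable b')
    (hc : Measurable c) (hc' : Measurable c') (hd : Measurable d) (hd' : Measurable d')
    (he : Measurable e) (he' : Measurable e')
    (hp : Measurable p) (hp' : Measurable p') (hq : Measurable q) (hq' : Measurable q')
    (hi₁ : Integrable (fun x => a x * c' x) μ₁)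
    (hi₂ : Integrable (fun x => c x * a' x) μ₁)
    (hi₃ : Integrable (fun x => b x * d' x) μ₁)
    (hi₄ : Integrable (fun x => d x * b' x) μ₁)
    (hi₅ : Integrable (fun x => e' x * c x) μ₁)
    (hi₆ : Integrable (fun x => e x * c' x) μ₁)
    (hi₇ : Integrable (fun y => p y * q' y) μ₂)
    (hi₈ : Integrable (fun y => q y * p' y) μ₂)
    (hi₉ : Integrable (fun y => p' y * q y) μ₂)
    (hrec₁ : (∫ x, (a x * c' x - c x * a' x) ∂μ₁)
      + (∫ y, (p y * q' y - q y * p' y) ∂μ₂) = 0)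
    (hrec₂ : (∫ x, (b x * d' x - d x * b' x) ∂μ₁) = 0)
    (htrans₁ : ∀ᵐ x ∂μ₁, c x = d x)
    (htrans₂ : ∀ᵐ x ∂μ₁, (1 / ρ) * c' x = (1 / ρhat) * d' x)
    (hadj₁ : ∀ᵐ x ∂μ₁, a x = b x - ρ * e x)
    (hadj₂ : ∀ᵐ x ∂μ₁, (1 / ρ) * a' x = (1 / ρhat) * b' x - e' x) :
    (∫ x, (e' x * c x - e x * c' x) ∂μ₁)
      = (1 / ρ) * ∫ y, (p' y * q y - p y * q' y) ∂μ₂ := by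
  have key : (∫ x, (e' x * c x - e x * c' x) ∂μ₁)
      = ∫ x, ((1 / ρ) * (a x * c' x - c x * a' x)
          - (1 / ρhat) * (b x * d' x - d x * b' x)) ∂μ₁ := by
    apply integral_congr_ae
    filter_upwards [htrans₁, htrans₂, hadj₁, hadj₂] with x h1 h2 h3 h4
    have h5 : ρ * (1 / ρ) = 1 := by field_simp
    rw [← h1, h3]
    linear_combination (-b x) * h2 + c x * h4 + (e x * c' x) * h5
  have h2 : (∫ y, (p' y * q y - p y * q' y) ∂μ₂)
      = - ∫ y, (p y * q' y - q y * p' y) ∂μ₂ := by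
    rw [← integral_neg]
    congr 1
    funext y
    ring
  have i1 : Integrable (fun x => (1 / ρ) * (a x * c' x - c x * a' x)) μ₁ :=
    (hi₁.sub hi₂).const_mul _
  have i2 : Integrable (fun x => (1 / ρhat) * (b x * d' x - d x * b' x)) μ₁ :=
    (hi₃.sub hi₄).const_mul _
  rw [key, integral_sub i1 i2,
    integral_const_mul, integral_const_mul, hrec₂, h2]
  linear_combination (1 / ρ) * hrec₁
end

section
/- Let (Γ₁, μ₁) and (Γ₂, μ₂) be measure spaces and ρ a nonzero complex constant. Let (e, e′), (c, c′) be pairs of measurable complex-valued functions on Γ₁, and (ẽ, ẽ′), (p, p′), (g, g′), (q, q′) pairs on Γ₂, such that every product appearing below is integrable. Assume: (adjoint identity) ∫_{Γ₁} (e′·c − e·c′) dμ₁ = (1/ρ) · ∫_{Γ₂} (p′·q − p·q′) dμ₂; (reciprocity) ∫_{Γ₂} (ẽ′·g − ẽ·g′) dμ₂ = 0; and (field decomposition) (1/ρ)·p + ẽ = g and (1/ρ)·p′ + ẽ′ = g′ hold μ₂-almost everywhere. Then ∫_{Γ₁} (e′·c − e·c′) dμ₁ + ∫_{Γ₂} (ẽ′·(g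 + q) − ẽ·(g′ + q′)) dμ₂ = ∫_{Γ₂} (g′·q − g·q′) dμ₂. -/
open MeasureTheory

/-- The simplification `δS_{nn'} = (i(-1)ⁿ/4)⟨u₋ₙ, δu_{n'}⟩_{∂B_ε}` of the variation of
the scattering matrix entry (up to the common constant factor), stated abstractly on
measure spaces. Here `(e, e')`, `(ẽ, ẽ')` are traces of the incident cylindrical wave
on `Γ₁` and `Γ₂`, `(c, c')`, `(q, q')` traces of the field variation, `(p, p')` traces
of the adjoint field, and `(g, g')` traces of the solution `u₋ₙ = (1/ρ)ũₙ + I₋ₙ`. -/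
theorem scattering_matrix_variation_simplification
    {Γ₁ Γ₂ : Type*} [MeasurableSpace Γ₁] [MeasurableSpace Γ₂]
    (μ₁ : Measure Γ₁) (μ₂ : Measure Γ₂)
    (ρ : ℂ) (hρ : ρ ≠ 0)
    (e e' c c' : Γ₁ → ℂ) (et et' p p' g g' q q' : Γ₂ → ℂ)
    (he : Measurable e) (he' : Measurable e') (hc : Measurable c) (hc' : Measurable c')
    (het : Measurable et) (het' : Measurable et')
    (hp : Measurable p) (hp' : Measurable p')
    (hg : Measurable g) (hg' : Measurable g')
    (hq : Measurable q) (hq' : Measurable q')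
    (hi₁ : Integrable (fun x => e' x * c x) μ₁)
    (hi₂ : Integrable (fun x => e x * c' x) μ₁)
    (hi₃ : Integrable (fun y => p' y * q y) μ₂)
    (hi₄ : Integrable (fun y => p y * q' y) μ₂)
    (hi₅ : Integrable (fun y => et' y * g y) μ₂)
    (hi₆ : Integrable (fun y => et y * g' y) μ₂)
    (hi₇ : Integrable (fun y => et' y * q y) μ₂)
    (hi₈ : Integrable (fun y => et y * q' y) μ₂)
    (hi₉ : Integrable (fun y => g' y * q y) μ₂)
    (hi₁₀ : Integrable (fun y => g y * q' y) μ₂)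
    (hadj : (∫ x, (e' x * c x - e x * c' x) ∂μ₁)
      = (1 / ρ) * ∫ y, (p' y * q y - p y * q' y) ∂μ₂)
    (hrec : (∫ y, (et' y * g y - et y * g' y) ∂μ₂) = 0)
    (hdec₁ : ∀ᵐ y ∂μ₂, (1 / ρ) * p y + et y = g y)
    (hdec₂ : ∀ᵐ y ∂μ₂, (1 / ρ) * p' y + et' y = g' y) :
    (∫ x, (e' x * c x - e x * c' x) ∂μ₁)
        + (∫ y, (et' y * (g y + q y) - et y * (g' y + q' y)) ∂μ₂)
      = ∫ y, (g' y * q y - g y * q' y) ∂μ₂ := by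
  have k₁ : Integrable (fun y => et' y * g y - et y * g' y) μ₂ := hi₅.sub hi₆
  have k₂ : Integrable (fun y => et' y * q y - et y * q' y) μ₂ := hi₇.sub hi₈
  have k₃ : Integrable (fun y => (1 / ρ) * (p' y * q y - p y * q' y)) μ₂ :=
    (hi₃.sub hi₄).const_mul (1 / ρ)
  have h1 : (∫ y, (et' y * (g y + q y) - et y * (g' y + q' y)) ∂μ₂)
      = (∫ y, (et' y * g y - et y * g' y) ∂μ₂) + ∫ y, (et' y * q y - et y * q' y) ∂μ₂ := by
    rw [← integral_add k₁ k₂]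
    refine integral_congr_ae (Filter.Eventually.of_forall fun y => ?_)
    beta_reduce
    ring
  rw [h1, hrec, hadj, zero_add, ← integral_const_mul,
    ← integral_add k₃ k₂]
  refine integral_congr_ae ?_
  filter_upwards [hdec₁, hdec₂] with y h₁ h₂
  rw [← h₁, ← h₂]
  ring
end

section
/- Assume k ≠ 0, s ≥ 1, and L > 0. Then the function h : ℝ → ℂ satisfies h(t) = O( t^(|n|−1) · exp(−s·L·t) ) as t → +∞ along the reals, i.e. h is big-O (with respect to the filter atTop on ℝ) of the function t ↦ t^(|n|−1) · exp(−s·L·t), where |n| is the absolute value of the integer n and the power t^(|n|−1) is an integer (zpow) power. -/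
open Complex Filter Asymptotics MeasureTheory

/-- The branch function `R(ξ) = (ξ² - k²)^{1/2}` with the principal complex square root. -/
noncomputable def schR (k ξ : ℂ) : ℂ := (ξ ^ 2 - k ^ 2) ^ ((1 : ℂ) / 2)

/-- The function `f_n` appearing in the integral representation of the Schlömilch series. -/
noncomputable def schF (k β : ℂ) (L : ℝ) (s n : ℤ) (ξ : ℂ) : ℂ :=
  Complex.exp ((s : ℂ) * (-Complex.I * β - schR k ξ * L)) * (ξ - schR k ξ) ^ n /
      (schR k ξ * (1 - Complex.exp (-Complex.I * β - schR k ξ * L))) +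
    Complex.exp ((s : ℂ) * (Complex.I * β - schR k ξ * L)) * (ξ + schR k ξ) ^ n /
      (schR k ξ * (1 - Complex.exp (Complex.I * β - schR k ξ * L)))

/-- The steepest-descent path `Q(t) = (t² - 2ikt)^{1/2}` (principal square root). -/
noncomputable def schQ (k : ℂ) (t : ℝ) : ℂ :=
  ((t : ℂ) ^ 2 - 2 * Complex.I * k * t) ^ ((1 : ℂ) / 2)

/-- The integrand `h(t) = (f_n(Q(t)) + f_n(-Q(t))) (t - ik)/Q(t)` of the integral
representation of the Schlömilch lattice sum. -/
noncomputable def schH (k β : ℂ) (L : ℝ) (s n : ℤ) (t : ℝ) : ℂ :=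
  (schF k β L s n (schQ k t) + schF k β L s n (-schQ k t)) *
    ((t : ℂ) - Complex.I * k) / schQ k t

lemma aux_zpow (k a b : ℂ) (hk : k ≠ 0) (n : ℤ) (T : ℝ) (hab : a * b = k ^ 2)
    (ha : ‖a‖ ≤ T) (hb : ‖b‖ ≤ T) :
    ‖a ^ n‖ ≤ ((1 + 1 / ‖k‖ ^ 2) * T) ^ |n| := by
  have hk0 : 0 < ‖k‖ := norm_pos_iff.mpr hk
  have hT : 0 ≤ T := (norm_nonneg a).trans ha
  have h1 : 0 ≤ 1 / ‖k‖ ^ 2 := by positivity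
  rcases le_total 0 n with h | h
  · rw [abs_of_nonneg h]
    lift n to ℕ using h
    simp only [zpow_natCast, norm_pow]
    apply pow_le_pow_left₀ (norm_nonneg _)
    nlinarith
  · rw [abs_of_nonpos h]
    obtain ⟨m, rfl⟩ : ∃ m : ℕ, n = -(m : ℤ) := ⟨n.natAbs, by omega⟩
    have ha0 : a ≠ 0 := by
      rintro rfl
      exact pow_ne_zero 2 hk (by rw [← hab, zero_mul])
    have hinv : a⁻¹ = b / k ^ 2 := by
      rw [← hab]
      have hb0 : b ≠ 0 := by
        rintro rfl
        exact pow_ne_zero 2 hk (by rw [← hab, mul_zero])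
      field_simp
    rw [zpow_neg, neg_neg, zpow_natCast, zpow_natCast, ← inv_pow, hinv, norm_pow]
    apply pow_le_pow_left₀ (norm_nonneg _)
    rw [norm_div, norm_pow]
    calc ‖b‖ / ‖k‖ ^ 2 ≤ T / ‖k‖ ^ 2 := by gcongr
      _ = 1 / ‖k‖ ^ 2 * T := by ring
      _ ≤ _ := by nlinarith

lemma aux_R (k : ℂ) (t : ℝ) (ξ : ℂ) (h : ξ ^ 2 = (t : ℂ) ^ 2 - 2 * Complex.I * k * t)
    (ht : 0 < t + k.im) : schR k ξ = t - Complex.I * k := by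
  have e : ξ ^ 2 - k ^ 2 = (t - Complex.I * k) ^ 2 := by
    rw [h]
    linear_combination (-k ^ 2) * Complex.I_sq
  have hre : 0 < ((t : ℂ) - Complex.I * k).re := by simpa using ht
  have harg := Complex.abs_arg_lt_pi_div_two_iff.mpr (Or.inl hre)
  rw [abs_lt] at harg
  unfold schR
  rw [e, one_div]
  exact Complex.pow_cpow_ofNat_inv (n := 2) (by simpa using harg.1) (by simpa using harg.2.le)

lemma aux_Qsq (k : ℂ) (t : ℝ) : schQ k t ^ 2 = (t : ℂ) ^ 2 - 2 * Complex.I * k * t := by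
  unfold schQ
  rw [one_div]
  exact Complex.cpow_ofNat_inv_pow _ 2

lemma aux_term (k c : ℂ) (L : ℝ) (s n : ℤ) (hk : k ≠ 0) (hL : 0 < L) (a b : ℝ → ℂ)
    (hab : ∀ᶠ t in atTop, a t * b t = k ^ 2)
    (ha : ∀ᶠ t in atTop, ‖a t‖ ≤ 4 * t) (hb : ∀ᶠ t in atTop, ‖b t‖ ≤ 4 * t) :
    (fun t : ℝ => Complex.exp ((s : ℂ) * (c - ((t : ℂ) - Complex.I * k) * L)) * a t ^ n /
      (((t : ℂ) - Complex.I * k) * (1 - Complex.exp (c - ((t : ℂ) - Complex.I * k) * L))))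
      =O[atTop] fun t : ℝ => t ^ (|n| - 1) * Real.exp (-(s : ℝ) * L * t) := by
  have hlim : Tendsto (fun t : ℝ => Real.exp (c.re - (t + k.im) * L)) atTop (nhds 0) := by
    apply Real.tendsto_exp_atBot.comp
    apply tendsto_atBot_add_const_left
    apply tendsto_neg_atTop_atBot.comp
    exact (tendsto_atTop_add_const_right _ _ tendsto_id).atTop_mul_const hL
  have hsmall := hlim.eventually (gt_mem_nhds (show (0:ℝ) < 1 / 2 by norm_num))
  apply IsBigO.of_bound (Real.exp (s * (c.re - k.im * L)) *
    ((1 + 1 / ‖k‖ ^ 2) * 4) ^ |n| * 4)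
  filter_upwards [hab, ha, hb, hsmall, eventually_ge_atTop (2 * ‖k‖), eventually_gt_atTop 0]
    with t hab ha hb hsm htk ht
  have hR : t / 2 ≤ ‖(t : ℂ) - Complex.I * k‖ := by
    have := norm_sub_norm_le (t : ℂ) (Complex.I * k)
    rw [norm_mul, Complex.norm_I, one_mul, Complex.norm_real, Real.norm_of_nonneg ht.le] at this
    linarith
  have hD : 1 / 2 ≤ ‖1 - Complex.exp (c - ((t : ℂ) - Complex.I * k) * L)‖ := by
    have := norm_sub_norm_le (1 : ℂ) (Complex.exp (c - ((t : ℂ) - Complex.I * k) * L))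
    rw [Complex.norm_exp, norm_one] at this
    have e : (c - ((t : ℂ) - Complex.I * k) * L).re = c.re - (t + k.im) * L := by simp
    rw [e] at this
    linarith
  have hE : ‖Complex.exp ((s : ℂ) * (c - ((t : ℂ) - Complex.I * k) * L))‖ =
      Real.exp (s * (c.re - k.im * L)) * Real.exp (-(s : ℝ) * L * t) := by
    rw [Complex.norm_exp, ← Real.exp_add]
    congr 1
    simp
    ring
  have hz := aux_zpow k (a t) (b t) hk n (4 * t) hab ha hb
  rw [norm_div, norm_mul, norm_mul, hE, Real.norm_of_nonneg (by positivity)]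
  calc _ ≤ Real.exp (s * (c.re - k.im * L)) * Real.exp (-(s : ℝ) * L * t) *
        ((1 + 1 / ‖k‖ ^ 2) * (4 * t)) ^ |n| / (t / 2 * (1 / 2)) := by gcongr
    _ = _ := by
      rw [← mul_assoc, mul_zpow _ t, zpow_sub_one₀ ht.ne']
      field_simp
      try ring

lemma aux_Q (k : ℂ) (t : ℝ) (ht : 0 < t) (htk : 4 * ‖k‖ ≤ t) :
    t / 2 ≤ ‖schQ k t‖ ∧ ‖schQ k t‖ ≤ 2 * t := by
  have h := congrArg norm (aux_Qsq k t)
  rw [norm_pow] at h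
  have e1 : ‖(t : ℂ) ^ 2‖ = t ^ 2 := by
    rw [norm_pow, Complex.norm_real, Real.norm_of_nonneg ht.le]
  have e2 : ‖2 * Complex.I * k * t‖ = 2 * ‖k‖ * t := by
    simp [abs_of_pos ht]
  have u := norm_sub_le ((t : ℂ) ^ 2) (2 * Complex.I * k * t)
  have l := norm_sub_norm_le ((t : ℂ) ^ 2) (2 * Complex.I * k * t)
  rw [← h, e1, e2] at u l
  have := norm_nonneg (schQ k t)
  constructor
  · apply le_of_sq_le_sq _ this
    nlinarith
  · apply le_of_sq_le_sq _ (by linarith)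
    nlinarith

/-- The integrand of the Schlömilch-series integral representation decays like
`t^{|n|-1} e^{-sLt}` as `t → +∞`. -/
theorem schH_isBigO_atTop (k β : ℂ) (L : ℝ) (s n : ℤ)
    (hk : k ≠ 0) (hs : 1 ≤ s) (hL : 0 < L) :
    (fun t : ℝ => schH k β L s n t)
      =O[atTop] fun t : ℝ => t ^ (|n| - 1) * Real.exp (-(s : ℝ) * L * t) := by
  have hq : ∀ᶠ t : ℝ in atTop, 0 < t ∧ 4 * ‖k‖ ≤ t :=
    (eventually_gt_atTop 0).and (eventually_ge_atTop _)
  have hRn : ∀ t : ℝ, 0 < t ∧ 4 * ‖k‖ ≤ t → ‖(t : ℂ) - Complex.I * k‖ ≤ 2 * t := by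
    intro t ⟨ht, htk⟩
    have := norm_sub_le (t : ℂ) (Complex.I * k)
    rw [norm_mul, Complex.norm_I, one_mul, Complex.norm_real, Real.norm_of_nonneg ht.le] at this
    linarith [norm_nonneg k]
  have hm : ∀ᶠ t : ℝ in atTop, ‖schQ k t - (t - Complex.I * k)‖ ≤ 4 * t := by
    filter_upwards [hq] with t ht
    linarith [norm_sub_le (schQ k t) (t - Complex.I * k), hRn t ht, (aux_Q k t ht.1 ht.2).2]
  have hp : ∀ᶠ t : ℝ in atTop, ‖schQ k t + (t - Complex.I * k)‖ ≤ 4 * t := by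
    filter_upwards [hq] with t ht
    linarith [norm_add_le (schQ k t) (t - Complex.I * k), hRn t ht, (aux_Q k t ht.1 ht.2).2]
  have hm' : ∀ᶠ t : ℝ in atTop, ‖-schQ k t - (t - Complex.I * k)‖ ≤ 4 * t := by
    filter_upwards [hp] with t ht
    rwa [← norm_neg, show -(-schQ k t - (t - Complex.I * k)) =
      schQ k t + (t - Complex.I * k) by ring]
  have hp' : ∀ᶠ t : ℝ in atTop, ‖-schQ k t + (t - Complex.I * k)‖ ≤ 4 * t := by
    filter_upwards [hm] with t ht
    rwa [← norm_neg, show -(-schQ k t + (t - Complex.I * k)) =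
      schQ k t - (t - Complex.I * k) by ring]
  have key : ∀ t : ℝ, schQ k t ^ 2 - (t - Complex.I * k) ^ 2 = k ^ 2 := fun t => by
    rw [aux_Qsq]
    linear_combination (-k ^ 2) * Complex.I_sq
  have T1 := aux_term k (-Complex.I * β) L s n hk hL _ _
    (Eventually.of_forall fun t => by linear_combination key t) hm hp
  have T2 := aux_term k (Complex.I * β) L s n hk hL _ _
    (Eventually.of_forall fun t => by linear_combination key t) hp hm
  have T3 := aux_term k (-Complex.I * β) L s n hk hL _ _
    (Eventually.of_forall fun t => by linear_combination key t) hm' hp'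
  have T4 := aux_term k (Complex.I * β) L s n hk hL _ _
    (Eventually.of_forall fun t => by linear_combination key t) hp' hm'
  have hquot : (fun t : ℝ => ((t : ℂ) - Complex.I * k) / schQ k t) =O[atTop]
      fun _ : ℝ => (1 : ℝ) := by
    apply IsBigO.of_bound 4
    filter_upwards [hq] with t ht
    have h1 := hRn t ht
    have h2 := (aux_Q k t ht.1 ht.2).1
    have h3 := ht.1
    rw [norm_div, norm_one, mul_one, div_le_iff₀ (by linarith)]
    linarith
  have hall := ((T1.add T2).add (T3.add T4)).mul hquot
  simp only [mul_one] at hall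
  refine hall.congr' ?_ EventuallyEq.rfl
  filter_upwards [eventually_gt_atTop (-k.im)] with t ht
  have r1 := aux_R k t (schQ k t) (aux_Qsq k t) (by linarith)
  have r2 := aux_R k t (-schQ k t) (by rw [neg_sq, aux_Qsq]) (by linarith)
  simp only [schH, schF, r1, r2]
  exact (mul_div_assoc _ _ _).symm
end

section
/- Let k ≠ 0, L > 0, s ≥ 1, and n ∈ ℤ. Then there exists a real a > 0 such that the function h : ℝ → ℂ is Lebesgue-integrable on the interval (a, ∞). -/
open Complex Filter Asymptotics MeasureTheory

lemma sch_zpow_bound (z : ℂ) (B : ℝ) (n : ℤ) (h1 : ‖z‖ ≤ B) (h2 : ‖z⁻¹‖ ≤ B) :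
    ‖z ^ n‖ ≤ B ^ n.natAbs := by
  obtain ⟨m, rfl | rfl⟩ := n.eq_nat_or_neg
  · simp only [zpow_natCast, norm_pow, Int.natAbs_natCast]
    exact pow_le_pow_left₀ (norm_nonneg _) h1 _
  · simp only [zpow_neg, zpow_natCast, Int.natAbs_neg, Int.natAbs_natCast]
    rw [← inv_pow, norm_pow]
    exact pow_le_pow_left₀ (norm_nonneg _) h2 _

lemma sch_term_bound (e z R : ℂ) (B x : ℝ) (s n : ℤ) (hs : 1 ≤ s) (hx : x ≤ -1)
    (he : e.re ≤ x) (hR : 1 ≤ ‖R‖) (h1 : ‖z‖ ≤ B) (h2 : ‖z⁻¹‖ ≤ B) :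
    ‖Complex.exp ((s : ℂ) * e) * z ^ n / (R * (1 - Complex.exp e))‖
      ≤ 2 * (Real.exp x * B ^ n.natAbs) := by
  have hz := sch_zpow_bound z B n h1 h2
  have hs' : (1 : ℝ) ≤ s := by exact_mod_cast hs
  have hE : ‖Complex.exp ((s : ℂ) * e)‖ ≤ Real.exp x := by
    rw [Complex.norm_exp]
    apply Real.exp_le_exp.mpr
    have : ((s : ℂ) * e).re = s * e.re := by simp
    rw [this]
    nlinarith
  have hE1 : ‖Complex.exp e‖ ≤ 1 / 2 := by
    rw [Complex.norm_exp]
    have h3 : Real.exp e.re ≤ Real.exp (-1) := Real.exp_le_exp.mpr (he.trans hx)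
    have h4 : Real.exp (-1) ≤ 1 / 2 := by
      rw [Real.exp_neg, one_div]
      apply inv_anti₀ (by norm_num)
      have := Real.add_one_le_exp 1
      linarith
    exact h3.trans h4
  have hD : 1 / 2 ≤ ‖1 - Complex.exp e‖ := by
    have := norm_sub_norm_le (1 : ℂ) (Complex.exp e)
    rw [norm_one] at this
    linarith
  have hD2 : 1 / 2 ≤ ‖R * (1 - Complex.exp e)‖ := by
    rw [norm_mul]; nlinarith
  have hB : 0 ≤ B := (norm_nonneg _).trans h1
  rw [norm_div, norm_mul, div_le_iff₀ (by linarith)]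
  have h5 : ‖Complex.exp ((s : ℂ) * e)‖ * ‖z ^ n‖ ≤ Real.exp x * B ^ n.natAbs := by
    gcongr
  have h6 : 0 ≤ Real.exp x * B ^ n.natAbs := by positivity
  nlinarith

lemma sch_sq_sqrt (z : ℂ) : (z ^ ((1 : ℂ) / 2)) ^ 2 = z := by
  rw [← Complex.cpow_nat_mul]; norm_num

lemma sch_sqrt_sq (z : ℂ) (h : 0 < z.re) : (z ^ 2) ^ ((1 : ℂ) / 2) = z := by
  have ha := abs_lt.mp (Complex.abs_arg_lt_pi_div_two_iff.mpr (Or.inl h))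
  have := Complex.pow_cpow_nat_inv (x := z) (n := 2) (by norm_num)
    (by push_cast; linarith [ha.1]) (by push_cast; linarith [ha.2])
  simpa using this

lemma sch_inv_bound (k a b : ℂ) (B M : ℝ) (hk : k ≠ 0) (h : a * b = k ^ 2 ∨ a * b = -k ^ 2)
    (hb : ‖b‖ ≤ M) (hB : M / ‖k‖ ^ 2 ≤ B) : ‖a⁻¹‖ ≤ B := by
  have hn : ‖a‖ * ‖b‖ = ‖k‖ ^ 2 := by
    rw [← norm_mul]; rcases h with h | h <;> rw [h] <;> simp
  have hk' : 0 < ‖k‖ := norm_pos_iff.mpr hk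
  have ha : ‖a‖ ≠ 0 := by
    intro h0; rw [h0, zero_mul] at hn; exact absurd hn.symm (by positivity)
  refine le_trans ?_ hB
  rw [norm_inv, ← hn, le_div_iff₀ (by rw [hn]; positivity)]
  field_simp
  exact hb

lemma schH_measurable (k β : ℂ) (L : ℝ) (s n : ℤ) :
    Measurable (fun t : ℝ => schH k β L s n t) := by
  have hQ : Measurable (fun t : ℝ => schQ k t) := by unfold schQ; fun_prop
  have hR : Measurable (fun x : ℂ => schR k x) := by unfold schR; fun_prop
  have hF : Measurable (fun x : ℂ => schF k β L s n x) := by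
    unfold schF
    have h1 : Measurable (fun x : ℂ => (x - schR k x) ^ n) := (measurable_id.sub hR).pow_const n
    have h2 : Measurable (fun x : ℂ => (x + schR k x) ^ n) := (measurable_id.add hR).pow_const n
    fun_prop
  unfold schH
  have h1 := hF.comp hQ
  have h2 := hF.comp hQ.neg
  have h3 : Measurable (fun t : ℝ => ((t : ℂ) - Complex.I * k)) := by fun_prop
  exact ((h1.add h2).mul h3).div hQ

lemma schF_bound (k β ξ w : ℂ) (L B M x : ℝ) (s n : ℤ) (hk : k ≠ 0) (hs : 1 ≤ s)
    (hR : schR k ξ = w) (hξ : ξ ^ 2 = w ^ 2 + k ^ 2) (hw : 1 ≤ ‖w‖)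
    (hx : x ≤ -1) (hxe : ‖β‖ - w.re * L ≤ x) (hM : ‖ξ‖ + ‖w‖ ≤ M) (hMB : M ≤ B)
    (hB : M / ‖k‖ ^ 2 ≤ B) :
    ‖schF k β L s n ξ‖ ≤ 4 * (Real.exp x * B ^ n.natAbs) := by
  unfold schF
  rw [hR]
  have hm : ‖ξ - w‖ ≤ M := (norm_sub_le _ _).trans hM
  have hp : ‖ξ + w‖ ≤ M := (norm_add_le _ _).trans hM
  have hβ := abs_le.mp (Complex.abs_im_le_norm β)
  have t1 := sch_term_bound (-Complex.I * β - w * L) (ξ - w) w B x s n hs hx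
    (by simp; linarith [hβ.2]) hw (hm.trans hMB)
    (sch_inv_bound k _ (ξ + w) B M hk (Or.inl (by linear_combination hξ)) hp hB)
  have t2 := sch_term_bound (Complex.I * β - w * L) (ξ + w) w B x s n hs hx
    (by simp; linarith [hβ.1]) hw (hp.trans hMB)
    (sch_inv_bound k _ (ξ - w) B M hk (Or.inl (by linear_combination hξ)) hm hB)
  refine (norm_add_le _ _).trans ?_
  linarith

lemma schH_bound (k β : ℂ) (L t : ℝ) (s n : ℤ) (hk : k ≠ 0) (hs : 1 ≤ s) (hL : 0 < L)
    (h1 : 2 + 2 * ‖k‖ ≤ t) (h2 : 2 * (‖β‖ + 1) / L ≤ t) :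
    ‖schH k β L s n t‖ ≤ 8 * (Real.exp (‖β‖ - t / 2 * L) *
      ((4 + 4 / ‖k‖ ^ 2) * t) ^ n.natAbs) * (2 * t) := by
  have hk' : 0 < ‖k‖ := norm_pos_iff.mpr hk
  have hkim := abs_le.mp (Complex.abs_im_le_norm k)
  have htn : ‖(t : ℂ)‖ = t := by rw [Complex.norm_real, Real.norm_of_nonneg (by linarith)]
  obtain ⟨w, hw⟩ : ∃ w : ℂ, w = (t : ℂ) - Complex.I * k := ⟨_, rfl⟩
  have hwre : t / 2 ≤ w.re := by
    rw [hw]; simp; linarith [hkim.1]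
  have hw1 : 1 ≤ ‖w‖ := by linarith [Complex.re_le_norm w]
  have hw2 : ‖w‖ ≤ 2 * t := by
    rw [hw]
    refine (norm_sub_le _ _).trans ?_
    rw [htn]; simp; linarith
  have hQ2 : schQ k t ^ 2 = w ^ 2 + k ^ 2 := by
    unfold schQ
    rw [sch_sq_sqrt, hw]
    linear_combination (-k ^ 2) * Complex.I_sq
  have hR : ∀ ξ : ℂ, ξ ^ 2 = w ^ 2 + k ^ 2 → schR k ξ = w := by
    intro ξ h
    unfold schR
    rw [h, add_sub_cancel_right]
    exact sch_sqrt_sq w (by linarith)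
  have hQn : ‖schQ k t‖ ^ 2 = t * ‖(t : ℂ) - 2 * Complex.I * k‖ := by
    rw [← norm_pow]
    nth_rewrite 2 [← htn]
    rw [← norm_mul]
    unfold schQ
    rw [sch_sq_sqrt]
    congr 1
    ring
  have h2k : ‖2 * Complex.I * k‖ = 2 * ‖k‖ := by simp
  have hd1 : ‖(t : ℂ) - 2 * Complex.I * k‖ ≤ 2 * t := by
    refine (norm_sub_le _ _).trans ?_
    rw [htn, h2k]; linarith
  have hd2 : 1 ≤ ‖(t : ℂ) - 2 * Complex.I * k‖ := by
    refine le_trans ?_ (norm_sub_norm_le _ _)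
    rw [htn, h2k]; linarith
  have hQ1 : 1 ≤ ‖schQ k t‖ := by
    by_contra hc
    push Not at hc
    nlinarith [norm_nonneg (schQ k t)]
  have hQ2t : ‖schQ k t‖ ≤ 2 * t := by
    by_contra hc
    push Not at hc
    nlinarith [norm_nonneg (schQ k t)]
  have hx : ‖β‖ - t / 2 * L ≤ -1 := by
    rw [div_le_iff₀ hL] at h2
    linarith
  have hxe : ‖β‖ - w.re * L ≤ ‖β‖ - t / 2 * L := by nlinarith
  have ht0 : 0 < t := by linarith
  have hMB : 4 * t ≤ (4 + 4 / ‖k‖ ^ 2) * t := by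
    have : 0 ≤ 4 / ‖k‖ ^ 2 := by positivity
    nlinarith
  have hB : 4 * t / ‖k‖ ^ 2 ≤ (4 + 4 / ‖k‖ ^ 2) * t := by
    have : (4 + 4 / ‖k‖ ^ 2) * t = 4 * t + 4 * t / ‖k‖ ^ 2 := by ring
    linarith
  have b1 := schF_bound k β (schQ k t) w L _ (4 * t) _ s n hk hs (hR _ hQ2) hQ2 hw1 hx hxe
    (by linarith) hMB hB
  have hQ2' : (-schQ k t) ^ 2 = w ^ 2 + k ^ 2 := by rw [neg_sq, hQ2]
  have b2 := schF_bound k β (-schQ k t) w L _ (4 * t) _ s n hk hs (hR _ hQ2') hQ2' hw1 hx hxe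
    (by rw [norm_neg]; linarith) hMB hB
  unfold schH
  rw [← hw, norm_div, norm_mul]
  refine (div_le_self (by positivity) hQ1).trans ?_
  refine mul_le_mul ((norm_add_le _ _).trans (by linarith)) hw2 (norm_nonneg _) (by positivity)

/-- Tail convergence of the integral representation of the Schlömilch series: for any
complex `k ≠ 0` and `β`, the integrand is Lebesgue-integrable on some interval `(a, ∞)`. -/
theorem schH_integrableOn_tail (k β : ℂ) (L : ℝ) (s n : ℤ)
    (hk : k ≠ 0) (hs : 1 ≤ s) (hL : 0 < L) :
    ∃ a : ℝ, 0 < a ∧ IntegrableOn (fun t : ℝ => schH k β L s n t) (Set.Ioi a) := by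
  refine ⟨max (2 + 2 * ‖k‖) (2 * (‖β‖ + 1) / L), ?_, ?_⟩
  · exact lt_max_of_lt_left (by positivity)
  set a := max (2 + 2 * ‖k‖) (2 * (‖β‖ + 1) / L) with ha
  have ha0 : 0 < a := lt_max_of_lt_left (by positivity)
  have hint := integrableOn_rpow_mul_exp_neg_mul_rpow (p := 1) (s := ((n.natAbs + 1 : ℕ) : ℝ))
    (b := L / 2) (by have : (0:ℝ) ≤ ((n.natAbs + 1 : ℕ) : ℝ) := Nat.cast_nonneg _
                     linarith) one_pos (by positivity)
  have hint2 := (hint.mono_set (Set.Ioi_subset_Ioi ha0.le)).const_mul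
    (16 * Real.exp ‖β‖ * (4 + 4 / ‖k‖ ^ 2) ^ n.natAbs)
  refine Integrable.mono' hint2 (schH_measurable k β L s n).aestronglyMeasurable ?_
  refine (ae_restrict_iff' measurableSet_Ioi).mpr (Filter.Eventually.of_forall ?_)
  intro t ht
  have ht' : a < t := ht
  refine (schH_bound k β L t s n hk hs hL ((le_max_left _ _).trans ht'.le)
    ((le_max_right _ _).trans ht'.le)).trans (le_of_eq ?_)
  rw [Real.rpow_natCast, Real.rpow_one, sub_eq_add_neg, Real.exp_add, mul_pow,
    show -(t / 2 * L) = -(L / 2) * t by ring]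
  ring
end

section
/- Let t be a real number with t > 0 and k a complex number such that t + Im k > 0 and t − 2ik ≠ 0. Then, with z^{1/2} the principal complex square root, ((Q(t))² − k²)^{1/2} = t − ik, where Q(t) = (t² − 2ikt)^{1/2}. -/
open Complex Filter Asymptotics MeasureTheory

/-- Along the steepest-descent path `ξ = Q(t)`, the branch function satisfies
`R(Q(t)) = t - ik`: the path stays on the correct sheet. -/
theorem schR_schQ (t : ℝ) (k : ℂ) (ht : 0 < t) (him : 0 < t + k.im)
    (hne : (t : ℂ) - 2 * Complex.I * k ≠ 0) :
    schR k (schQ k t) = (t : ℂ) - Complex.I * k := by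
  have h2 : ((1 : ℂ) / 2) = (2 : ℂ)⁻¹ := by norm_num
  have hq : schQ k t ^ 2 = (t : ℂ) ^ 2 - 2 * Complex.I * k * t := by
    unfold schQ
    rw [h2]
    exact Complex.cpow_nat_inv_pow _ two_ne_zero
  have h3 : schQ k t ^ 2 - k ^ 2 = ((t : ℂ) - Complex.I * k) ^ 2 := by
    rw [hq]
    linear_combination (-k ^ 2) * Complex.I_sq
  unfold schR
  rw [h3, h2]
  exact Complex.sq_cpow_two_inv (by simpa using him)
end
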